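/- arXiv:2511.16992 — 3 statements merged into one kernel-verified Lean document; each statement's English description precedes it below -/
import Mathlib

section
/- Let G, G' ∈ ℝ^{M×M} be symmetric positive semidefinite matrices and β > 0. Let λ* be a minimizer over Δ_M of λ ↦ λᵀGλ + (β/2)‖λ‖₂², and let λ'* be a minimizer over Δ_M of λ ↦ λᵀG'λ + (β/2)‖λ‖₂². Then ‖λ* − λ'*‖₂ ≤ (4/β)‖G − G'‖_op. -/
open scoped BigOperators

/-- The probability simplex `Δ_M ⊆ ℝ^M`. -/
def probSimplex (M : ℕ) : Set (EuclideanSpace ℝ (Fin M)) :=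
  {x | (∀ i, 0 ≤ x i) ∧ ∑ i, x i = 1}

/-- The quadratic form `λᵀ G λ`. -/
def quadForm {M : ℕ} (G : Matrix (Fin M) (Fin M) ℝ)
    (x : EuclideanSpace ℝ (Fin M)) : ℝ :=
  ∑ i, ∑ j, x i * G i j * x j

/-- The operator (spectral) norm of a real matrix. -/
noncomputable def opNorm {m n : ℕ} (A : Matrix (Fin m) (Fin n) ℝ) : ℝ :=
  ‖LinearMap.toContinuousLinearMap (Matrix.toEuclideanLin A)‖

theorem quadForm_eq_inner {M : ℕ} (G : Matrix (Fin M) (Fin M) ℝ)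
    (x : EuclideanSpace ℝ (Fin M)) :
    quadForm G x = inner ℝ x (Matrix.toEuclideanLin G x) := by
  simp only [quadForm, PiLp.inner_apply, Matrix.toLpLin_apply, Matrix.mulVec, dotProduct,
    RCLike.inner_apply, conj_trivial, Finset.sum_mul]
  exact Finset.sum_congr rfl fun i _ => Finset.sum_congr rfl fun j _ => by ring

theorem quadForm_nonneg {M : ℕ} {G : Matrix (Fin M) (Fin M) ℝ} (hG : G.PosSemidef)
    (x : EuclideanSpace ℝ (Fin M)) : 0 ≤ quadForm G x := by
  have h := hG.dotProduct_mulVec_nonneg x.ofLp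
  simpa [quadForm, dotProduct, Matrix.mulVec, Finset.mul_sum, mul_assoc] using h

theorem quadForm_sub {M : ℕ} (G G' : Matrix (Fin M) (Fin M) ℝ)
    (x : EuclideanSpace ℝ (Fin M)) :
    quadForm (G - G') x = quadForm G x - quadForm G' x := by
  simp [quadForm_eq_inner, inner_sub_right]

/-- The parallelogram identity for a quadratic form, in midpoint form. -/
theorem quadForm_half_smul_add {M : ℕ} (G : Matrix (Fin M) (Fin M) ℝ)
    (x y : EuclideanSpace ℝ (Fin M)) :
    quadForm G ((1 / 2 : ℝ) • (x + y)) =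
      (quadForm G x + quadForm G y) / 2 - quadForm G (x - y) / 4 := by
  simp only [quadForm_eq_inner, map_smul, map_add, map_sub, inner_add_left, inner_add_right,
    inner_sub_left, inner_sub_right, real_inner_smul_left, real_inner_smul_right]
  ring

theorem norm_sq_half_smul_add {E : Type*} [NormedAddCommGroup E] [InnerProductSpace ℝ E]
    (x y : E) :
    ‖(1 / 2 : ℝ) • (x + y)‖ ^ 2 = (‖x‖ ^ 2 + ‖y‖ ^ 2) / 2 - ‖x - y‖ ^ 2 / 4 := by
  rw [norm_smul, mul_pow, norm_add_sq_real, norm_sub_sq_real]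
  norm_num
  ring

theorem half_smul_add_mem_probSimplex {M : ℕ} {x y : EuclideanSpace ℝ (Fin M)}
    (hx : x ∈ probSimplex M) (hy : y ∈ probSimplex M) :
    (1 / 2 : ℝ) • (x + y) ∈ probSimplex M := by
  refine ⟨fun i => ?_, ?_⟩
  · have := hx.1 i
    have := hy.1 i
    simp only [PiLp.smul_apply, PiLp.add_apply, smul_eq_mul]
    positivity
  · simp only [PiLp.smul_apply, PiLp.add_apply, smul_eq_mul, ← Finset.mul_sum,
      Finset.sum_add_distrib, hx.2, hy.2]
    norm_num

theorem norm_le_one_of_mem_probSimplex {M : ℕ} {x : EuclideanSpace ℝ (Fin M)}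
    (hx : x ∈ probSimplex M) : ‖x‖ ≤ 1 := by
  have h : ‖x‖ ^ 2 ≤ 1 := by
    rw [EuclideanSpace.real_norm_sq_eq, ← hx.2]
    refine Finset.sum_le_sum fun i _ => ?_
    have hi : x i ≤ 1 :=
      hx.2 ▸ Finset.single_le_sum (f := fun j => x j) (fun j _ => hx.1 j) (Finset.mem_univ i)
    nlinarith [hx.1 i]
  nlinarith [norm_nonneg x]

/-- Quadratic growth of the regularized objective away from its minimizer. -/
theorem quadratic_growth_of_isMin {M : ℕ} {G : Matrix (Fin M) (Fin M) ℝ} (hG : G.PosSemidef)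
    {β : ℝ} {x y : EuclideanSpace ℝ (Fin M)}
    (hx : x ∈ probSimplex M) (hy : y ∈ probSimplex M)
    (hmin : ∀ l ∈ probSimplex M,
      quadForm G x + (β / 2) * ‖x‖ ^ 2 ≤ quadForm G l + (β / 2) * ‖l‖ ^ 2) :
    quadForm G x + (β / 2) * ‖x‖ ^ 2 + (β / 4) * ‖x - y‖ ^ 2 ≤
      quadForm G y + (β / 2) * ‖y‖ ^ 2 := by
  have h := hmin _ (half_smul_add_mem_probSimplex hx hy)
  rw [quadForm_half_smul_add, norm_sq_half_smul_add] at h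
  linarith [quadForm_nonneg hG (x - y)]

theorem quadForm_sub_quadForm_le {M : ℕ} {A : Matrix (Fin M) (Fin M) ℝ} (hA : A.IsHermitian)
    (x y : EuclideanSpace ℝ (Fin M)) :
    quadForm A y - quadForm A x ≤ opNorm A * ‖x - y‖ * ‖x + y‖ := by
  have hsymm : inner ℝ x (Matrix.toEuclideanLin A y) = inner ℝ y (Matrix.toEuclideanLin A x) := by
    rw [← Matrix.isSymmetric_toEuclideanLin_iff.mpr hA x y, real_inner_comm]
  have hfactor : quadForm A y - quadForm A x =
      inner ℝ (y - x) (Matrix.toEuclideanLin A (x + y)) := by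
    simp only [quadForm_eq_inner, map_add, inner_add_right, inner_sub_left]
    linarith
  have hop : ‖Matrix.toEuclideanLin A (x + y)‖ ≤ opNorm A * ‖x + y‖ :=
    (LinearMap.toContinuousLinearMap (Matrix.toEuclideanLin A)).le_opNorm (x + y)
  calc quadForm A y - quadForm A x
      ≤ ‖y - x‖ * ‖Matrix.toEuclideanLin A (x + y)‖ := hfactor ▸ real_inner_le_norm _ _
    _ ≤ ‖y - x‖ * (opNorm A * ‖x + y‖) := by gcongr
    _ = opNorm A * ‖x - y‖ * ‖x + y‖ := by rw [norm_sub_rev y x]; ring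

/-- If `G, G'` are symmetric positive semidefinite, `β > 0`, and
`λ*`, `λ'*` minimize `λ ↦ λᵀGλ + (β/2)‖λ‖²` resp. `λ ↦ λᵀG'λ + (β/2)‖λ‖²` over `Δ_M`,
then `‖λ* − λ'*‖₂ ≤ (4/β)‖G − G'‖_op`. -/
theorem stmt_7 {M : ℕ} (G G' : Matrix (Fin M) (Fin M) ℝ)
    (hG : G.PosSemidef) (hG' : G'.PosSemidef) (β : ℝ) (hβ : 0 < β)
    (lamStar lamStar' : EuclideanSpace ℝ (Fin M))
    (hmem : lamStar ∈ probSimplex M) (hmem' : lamStar' ∈ probSimplex M)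
    (hmin : ∀ l ∈ probSimplex M,
      quadForm G lamStar + (β / 2) * ‖lamStar‖ ^ 2 ≤ quadForm G l + (β / 2) * ‖l‖ ^ 2)
    (hmin' : ∀ l ∈ probSimplex M,
      quadForm G' lamStar' + (β / 2) * ‖lamStar'‖ ^ 2 ≤ quadForm G' l + (β / 2) * ‖l‖ ^ 2) :
    ‖lamStar - lamStar'‖ ≤ (4 / β) * opNorm (G - G') := by
  have hgrow := quadratic_growth_of_isMin hG hmem hmem' hmin
  have hgrow' := quadratic_growth_of_isMin hG' hmem' hmem hmin'
  rw [norm_sub_rev lamStar' lamStar] at hgrow'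
  have hdiff := quadForm_sub_quadForm_le (hG.isHermitian.sub hG'.isHermitian) lamStar lamStar'
  rw [quadForm_sub, quadForm_sub] at hdiff
  have hsum : ‖lamStar + lamStar'‖ ≤ 2 := by
    linarith [norm_add_le lamStar lamStar', norm_le_one_of_mem_probSimplex hmem,
      norm_le_one_of_mem_probSimplex hmem']
  have hop : 0 ≤ opNorm (G - G') := norm_nonneg _
  have hd : 0 ≤ ‖lamStar - lamStar'‖ := norm_nonneg _
  have hbound := mul_le_mul_of_nonneg_left hsum (mul_nonneg hop hd)
  rw [div_mul_eq_mul_div, le_div_iff₀ hβ]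
  rcases hd.eq_or_lt with h0 | hpos
  · rw [← h0]
    linarith
  · refine le_of_mul_le_mul_right ?_ hpos
    linarith
end

section
/- Let g_1, …, g_M ∈ ℝ^d and g'_1, …, g'_M ∈ ℝ^d satisfy ‖g_j‖₂ ≤ R and ‖g'_j‖₂ ≤ R for all j ∈ [M], and let β > 0. Let λ* be a minimizer over Δ_M of λ ↦ ‖Σ_{j=1}^M λ_j g_j‖₂² + (β/2)‖λ‖₂², and let λ'* be a minimizer over Δ_M of λ ↦ ‖Σ_{j=1}^M λ_j g'_j‖₂² + (β/2)‖λ‖₂². Then ‖λ* − λ'*‖₂ ≤ (8RM/β) · max_{j ∈ [M]} ‖g_j − g'_j‖₂. -/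
open scoped BigOperators

section QuadraticGrowth

variable {V W : Type*} [NormedAddCommGroup V] [InnerProductSpace ℝ V]
  [NormedAddCommGroup W] [InnerProductSpace ℝ W]

/-- A minimizer `x` of `v ↦ ‖T v‖² + c ‖v‖²` over a convex set has quadratic growth. -/
theorem quadratic_growth_of_isMinOn (T : V →ₗ[ℝ] W) (c : ℝ) {s : Set V} (hs : Convex ℝ s)
    {x y : V} (hx : x ∈ s) (hy : y ∈ s)
    (hmin : IsMinOn (fun v => ‖T v‖ ^ 2 + c * ‖v‖ ^ 2) s x) :
    c / 2 * ‖x - y‖ ^ 2 ≤ (‖T y‖ ^ 2 + c * ‖y‖ ^ 2) - (‖T x‖ ^ 2 + c * ‖x‖ ^ 2) := by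
  have hmid : (1 / 2 : ℝ) • (x + y) ∈ s := by
    rw [smul_add]
    exact hs hx hy (by norm_num) (by norm_num) (by norm_num)
  have key : ‖T x‖ ^ 2 + c * ‖x‖ ^ 2 ≤
      ‖T ((1 / 2 : ℝ) • (x + y))‖ ^ 2 + c * ‖(1 / 2 : ℝ) • (x + y)‖ ^ 2 := hmin hmid
  rw [map_smul, map_add, norm_smul, norm_smul, mul_pow, mul_pow] at key
  norm_num at key
  have hT := parallelogram_law_with_norm ℝ (T x) (T y)
  have hV := congrArg (c * ·) (parallelogram_law_with_norm ℝ x y)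
  nlinarith [sq_nonneg ‖T x - T y‖]

/-- Second-order difference of squared norms under a perturbation of the vectors. -/
theorem norm_sq_sub_norm_sq_sub_le (a a' b b' : W) :
    (‖a‖ ^ 2 - ‖a'‖ ^ 2) - (‖b‖ ^ 2 - ‖b'‖ ^ 2) ≤
      ‖(a - a') - (b - b')‖ * ‖a + a'‖ + ‖b - b'‖ * ‖(a - b) + (a' - b')‖ := by
  have h : (‖a‖ ^ 2 - ‖a'‖ ^ 2) - (‖b‖ ^ 2 - ‖b'‖ ^ 2) =
      inner ℝ ((a - a') - (b - b')) (a + a') + inner ℝ (b - b') ((a - b) + (a' - b')) := by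
    simp only [← real_inner_self_eq_norm_sq, inner_add_right, inner_sub_left, inner_sub_right]
    rw [real_inner_comm a a']
    rw [real_inner_comm b b']
    ring
  rw [h]
  exact add_le_add (real_inner_le_norm _ _) (real_inner_le_norm _ _)

end QuadraticGrowth

theorem convex_probSimplex (M : ℕ) : Convex ℝ (probSimplex M) := by
  rintro x ⟨hx, hx1⟩ y ⟨hy, hy1⟩ a b ha hb hab
  refine ⟨fun i => ?_, ?_⟩
  · simpa using add_nonneg (mul_nonneg ha (hx i)) (mul_nonneg hb (hy i))
  · simp [Finset.sum_add_distrib, ← Finset.mul_sum, hx1, hy1, hab]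

/-- The linear map `l ↦ ∑ j, l j • g j` on Euclidean space. -/
noncomputable def weightedSum {M : ℕ} {W : Type*} [AddCommGroup W] [Module ℝ W]
    (g : Fin M → W) : EuclideanSpace ℝ (Fin M) →ₗ[ℝ] W where
  toFun l := ∑ j, l j • g j
  map_add' x y := by simp [add_smul, Finset.sum_add_distrib]
  map_smul' c x := by simp [mul_smul, Finset.smul_sum]

section WeightedSum

variable {M : ℕ} {W : Type*} [NormedAddCommGroup W] [NormedSpace ℝ W]

theorem weightedSum_apply (g : Fin M → W) (l : EuclideanSpace ℝ (Fin M)) :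
    weightedSum g l = ∑ j, l j • g j := rfl

theorem weightedSum_add_apply (g h : Fin M → W) (l : EuclideanSpace ℝ (Fin M)) :
    weightedSum (g + h) l = weightedSum g l + weightedSum h l := by
  simp [weightedSum_apply, Finset.sum_add_distrib]

theorem weightedSum_sub_apply (g h : Fin M → W) (l : EuclideanSpace ℝ (Fin M)) :
    weightedSum (g - h) l = weightedSum g l - weightedSum h l := by
  simp [weightedSum_apply, smul_sub, Finset.sum_sub_distrib]

theorem norm_weightedSum_le_sum_abs {g : Fin M → W} {C : ℝ} (hg : ∀ j, ‖g j‖ ≤ C)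
    (l : EuclideanSpace ℝ (Fin M)) : ‖weightedSum g l‖ ≤ (∑ j, |l j|) * C := by
  rw [weightedSum_apply, Finset.sum_mul]
  refine norm_sum_le_of_le _ fun j _ => ?_
  rw [norm_smul, Real.norm_eq_abs]
  exact mul_le_mul_of_nonneg_left (hg j) (abs_nonneg _)

theorem norm_weightedSum_le_of_mem_probSimplex {g : Fin M → W} {C : ℝ} (hg : ∀ j, ‖g j‖ ≤ C)
    {l : EuclideanSpace ℝ (Fin M)} (hl : l ∈ probSimplex M) : ‖weightedSum g l‖ ≤ C := by
  have h := norm_weightedSum_le_sum_abs hg l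
  rwa [Finset.sum_congr rfl fun j _ => abs_of_nonneg (hl.1 j), hl.2, one_mul] at h

theorem norm_weightedSum_le_card_mul_norm {g : Fin M → W} {C : ℝ} (hC : 0 ≤ C)
    (hg : ∀ j, ‖g j‖ ≤ C) (l : EuclideanSpace ℝ (Fin M)) :
    ‖weightedSum g l‖ ≤ M * ‖l‖ * C := by
  refine (norm_weightedSum_le_sum_abs hg l).trans (mul_le_mul_of_nonneg_right ?_ hC)
  simpa using Finset.sum_le_card_nsmul Finset.univ (fun j => |l j|) ‖l‖
    fun j _ => PiLp.norm_apply_le l j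

end WeightedSum

/-- (Regularization controls disagreement.) Let `g_j, g'_j ∈ ℝ^d` with
`‖g_j‖, ‖g'_j‖ ≤ R` for all `j ∈ [M]`, and `β > 0`. If `λ*` minimizes
`λ ↦ ‖Σ_j λ_j g_j‖² + (β/2)‖λ‖²` over `Δ_M` and `λ'*` minimizes the analogous objective
with the `g'_j`, then `‖λ* − λ'*‖₂ ≤ (8RM/β) · max_j ‖g_j − g'_j‖₂`. -/
theorem stmt_11 {d M : ℕ} (hM : 0 < M)
    (g g' : Fin M → EuclideanSpace ℝ (Fin d)) (R : ℝ)
    (hg : ∀ j, ‖g j‖ ≤ R) (hg' : ∀ j, ‖g' j‖ ≤ R)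
    (β : ℝ) (hβ : 0 < β)
    (lamStar lamStar' : EuclideanSpace ℝ (Fin M))
    (hmem : lamStar ∈ probSimplex M) (hmem' : lamStar' ∈ probSimplex M)
    (hmin : ∀ l ∈ probSimplex M,
      ‖∑ j, lamStar j • g j‖ ^ 2 + (β / 2) * ‖lamStar‖ ^ 2 ≤
        ‖∑ j, l j • g j‖ ^ 2 + (β / 2) * ‖l‖ ^ 2)
    (hmin' : ∀ l ∈ probSimplex M,
      ‖∑ j, lamStar' j • g' j‖ ^ 2 + (β / 2) * ‖lamStar'‖ ^ 2 ≤
        ‖∑ j, l j • g' j‖ ^ 2 + (β / 2) * ‖l‖ ^ 2) :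
    ‖lamStar - lamStar'‖ ≤
      (8 * R * M / β) *
        Finset.univ.sup' (Finset.univ_nonempty_iff.mpr ⟨⟨0, hM⟩⟩)
          (fun j => ‖g j - g' j‖) := by
  set ε := Finset.univ.sup' (Finset.univ_nonempty_iff.mpr ⟨⟨0, hM⟩⟩)
    (fun j => ‖g j - g' j‖)
  have hD : ∀ j, ‖(g - g') j‖ ≤ ε := fun j =>
    Finset.le_sup' (fun j => ‖g j - g' j‖) (Finset.mem_univ j)
  have hS : ∀ j, ‖(g + g') j‖ ≤ 2 * R := fun j =>
    (norm_add_le _ _).trans (by linarith [hg j, hg' j])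
  have hε0 : 0 ≤ ε := (norm_nonneg _).trans (hD ⟨0, hM⟩)
  have hR0 : 0 ≤ 2 * R := (norm_nonneg _).trans (hS ⟨0, hM⟩)
  have h₁ := quadratic_growth_of_isMinOn (weightedSum g) (β / 2) (convex_probSimplex M)
    hmem hmem' hmin
  have h₂ := quadratic_growth_of_isMinOn (weightedSum g') (β / 2) (convex_probSimplex M)
    hmem' hmem hmin'
  have h₃ := norm_sq_sub_norm_sq_sub_le (weightedSum g lamStar') (weightedSum g' lamStar')
    (weightedSum g lamStar) (weightedSum g' lamStar)
  rw [← weightedSum_sub_apply, ← weightedSum_sub_apply, ← weightedSum_add_apply, ← map_sub,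
    ← map_sub, ← map_sub, ← weightedSum_add_apply] at h₃
  rw [norm_sub_rev lamStar' lamStar] at h₂
  have h₄ := mul_le_mul (norm_weightedSum_le_card_mul_norm hε0 hD (lamStar' - lamStar))
    (norm_weightedSum_le_of_mem_probSimplex hS hmem') (norm_nonneg _) (by positivity)
  have h₅ := mul_le_mul (norm_weightedSum_le_of_mem_probSimplex hD hmem)
    (norm_weightedSum_le_card_mul_norm hR0 hS (lamStar' - lamStar)) (norm_nonneg _) hε0
  rw [norm_sub_rev lamStar' lamStar] at h₄ h₅
  rw [div_mul_eq_mul_div, le_div_iff₀ hβ]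
  rcases (norm_nonneg (lamStar - lamStar')).eq_or_lt with h0 | hpos
  · rw [← h0, zero_mul]
    have : 0 ≤ R := by linarith
    positivity
  · refine le_of_mul_le_mul_left ?_ hpos
    linarith
end

section
/- Let C ≥ 1, M ≥ 1, R ≥ 0. For c = 1, …, C let λ^c ∈ Δ_M and let g^{j,c} ∈ ℝ^d with ‖g^{j,c}‖₂ ≤ R for all j ∈ [M], and set λ̄ = (1/C) Σ_{c=1}^C λ^c. Then ‖(1/C) Σ_{c=1}^C Σ_{j=1}^M g^{j,c} (λ^{j,c} − λ̄_j)‖₂² ≤ (2R²√M / C²) Σ_{c=1}^C Σ_{c'=1}^C ‖λ^c − λ^{c'}‖₂, where λ^{j,c} denotes the j-th coordinate of λ^c. -/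
open scoped BigOperators

theorem average_mem_probSimplex {M C : ℕ} (hC : 1 ≤ C)
    {lam : Fin C → EuclideanSpace ℝ (Fin M)} (hlam : ∀ c, lam c ∈ probSimplex M) :
    (1 / (C : ℝ)) • ∑ c, lam c ∈ probSimplex M := by
  have hC0 : (C : ℝ) ≠ 0 := by positivity
  have hcoord (j : Fin M) :
      ((1 / (C : ℝ)) • ∑ c, lam c) j = (1 / (C : ℝ)) * ∑ c, lam c j := by
    simp
  refine ⟨fun j => ?_, ?_⟩
  · rw [hcoord]
    exact mul_nonneg (by positivity) (Finset.sum_nonneg fun c _ => (hlam c).1 j)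
  · simp_rw [hcoord]
    rw [← Finset.mul_sum, Finset.sum_comm]
    simp [(hlam _).2, hC0]

theorem sum_abs_sub_le_two_of_mem_probSimplex {M : ℕ} {p q : EuclideanSpace ℝ (Fin M)}
    (hp : p ∈ probSimplex M) (hq : q ∈ probSimplex M) : ∑ j, |p j - q j| ≤ 2 := by
  calc ∑ j, |p j - q j| ≤ ∑ j, (p j + q j) :=
        Finset.sum_le_sum fun j _ =>
          abs_le.2 ⟨by linarith [hp.1 j], by linarith [hq.1 j]⟩
    _ = 2 := by rw [Finset.sum_add_distrib, hp.2, hq.2]; norm_num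

theorem sum_abs_le_sqrt_mul_norm {M : ℕ} (v : EuclideanSpace ℝ (Fin M)) :
    ∑ j, |v j| ≤ √M * ‖v‖ := by
  rw [EuclideanSpace.norm_eq, ← Real.sqrt_mul (Nat.cast_nonneg M)]
  refine Real.le_sqrt_of_sq_le ?_
  simpa using sq_sum_le_card_mul_sum_sq (s := Finset.univ) (f := fun j => |v j|)

theorem sum_abs_sub_average_le {M C : ℕ} (hC : 1 ≤ C)
    (p : EuclideanSpace ℝ (Fin M)) (lam : Fin C → EuclideanSpace ℝ (Fin M)) :
    ∑ j, |p j - ((1 / (C : ℝ)) • ∑ c, lam c) j| ≤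
      1 / (C : ℝ) * ∑ c, ∑ j, |p j - lam c j| := by
  have hC0 : (C : ℝ) ≠ 0 := by positivity
  rw [Finset.sum_comm, Finset.mul_sum]
  refine Finset.sum_le_sum fun j _ => ?_
  have hj : p j - ((1 / (C : ℝ)) • ∑ c, lam c) j = 1 / (C : ℝ) * ∑ c, (p j - lam c j) := by
    simp [Finset.sum_sub_distrib]
    field_simp
  rw [hj, abs_mul, abs_of_nonneg (by positivity : 0 ≤ 1 / (C : ℝ))]
  gcongr
  exact Finset.abs_sum_le_sum_abs _ _

theorem norm_smul_sum_smul_le {ι κ E : Type*} [Fintype ι] [Fintype κ]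
    [SeminormedAddCommGroup E] [NormedSpace ℝ E] {a R : ℝ} (ha : 0 ≤ a)
    (w : ι → κ → ℝ) {g : ι → κ → E} (hg : ∀ c j, ‖g c j‖ ≤ R) :
    ‖a • ∑ c, ∑ j, w c j • g c j‖ ≤ R * (a * ∑ c, ∑ j, |w c j|) := by
  have h : ‖∑ c, ∑ j, w c j • g c j‖ ≤ ∑ c, ∑ j, |w c j| * R :=
    norm_sum_le_of_le _ fun c _ => norm_sum_le_of_le _ fun j _ => by
      rw [norm_smul, Real.norm_eq_abs]
      exact mul_le_mul_of_nonneg_left (hg c j) (abs_nonneg _)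
  rw [norm_smul, Real.norm_of_nonneg ha]
  refine (mul_le_mul_of_nonneg_left h ha).trans_eq ?_
  simp_rw [← Finset.sum_mul]
  ring

/-- Deterministic core of the multi-objective disagreement-drift bound:
with `λ^c ∈ Δ_M`, `‖g^{j,c}‖ ≤ R`, and `λ̄ = (1/C)Σ_c λ^c`,
`‖(1/C) Σ_c Σ_j g^{j,c}(λ^{j,c} − λ̄_j)‖² ≤ (2R²√M/C²) Σ_c Σ_{c'} ‖λ^c − λ^{c'}‖₂`. -/
theorem stmt_16 {d M : ℕ} (C : ℕ) (hC : 1 ≤ C) (hM : 1 ≤ M)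
    (R : ℝ) (hR : 0 ≤ R)
    (lam : Fin C → EuclideanSpace ℝ (Fin M)) (hlam : ∀ c, lam c ∈ probSimplex M)
    (g : Fin C → Fin M → EuclideanSpace ℝ (Fin d)) (hg : ∀ c j, ‖g c j‖ ≤ R)
    (lamBar : EuclideanSpace ℝ (Fin M)) (hbar : lamBar = (1 / (C : ℝ)) • ∑ c, lam c) :
    ‖(1 / (C : ℝ)) • ∑ c, ∑ j, (lam c j - lamBar j) • g c j‖ ^ 2 ≤
      (2 * R ^ 2 * Real.sqrt M / (C : ℝ) ^ 2) * ∑ c, ∑ c', ‖lam c - lam c'‖ := by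
  subst hbar
  set m := (1 / (C : ℝ)) • ∑ c, lam c
  have hC0 : (0 : ℝ) < C := by exact_mod_cast hC
  set S := 1 / (C : ℝ) * ∑ c, ∑ j, |lam c j - m j| with hS
  have hS0 : 0 ≤ S := by positivity
  have hS2 : S ≤ 2 := by
    have h : ∑ c, ∑ j, |lam c j - m j| ≤ ∑ _c : Fin C, (2 : ℝ) :=
      Finset.sum_le_sum fun c _ =>
        sum_abs_sub_le_two_of_mem_probSimplex (hlam c) (average_mem_probSimplex hC hlam)
    rw [hS, one_div, inv_mul_le_iff₀ hC0]
    simpa using h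
  have hSD : S ≤ √M / (C : ℝ) ^ 2 * ∑ c, ∑ c', ‖lam c - lam c'‖ := by
    calc S ≤ 1 / (C : ℝ) * ∑ c, 1 / (C : ℝ) * ∑ c', √M * ‖lam c - lam c'‖ := by
          rw [hS]
          gcongr with c
          refine (sum_abs_sub_average_le hC (lam c) lam).trans ?_
          gcongr with c'
          exact sum_abs_le_sqrt_mul_norm (lam c - lam c')
      _ = √M / (C : ℝ) ^ 2 * ∑ c, ∑ c', ‖lam c - lam c'‖ := by
          simp_rw [← Finset.mul_sum]
          ring
  calc ‖(1 / (C : ℝ)) • ∑ c, ∑ j, (lam c j - m j) • g c j‖ ^ 2 ≤ (R * S) ^ 2 := by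
        gcongr
        exact norm_smul_sum_smul_le (by positivity) _ hg
    _ ≤ 2 * R ^ 2 * S := by
        nlinarith [mul_nonneg (sq_nonneg R) (mul_nonneg hS0 (sub_nonneg.2 hS2))]
    _ ≤ 2 * R ^ 2 * (√M / (C : ℝ) ^ 2 * ∑ c, ∑ c', ‖lam c - lam c'‖) := by gcongr
    _ = _ := by ring
end
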